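/- arXiv:2406.18307 — 2 statements merged into one kernel-verified Lean document; each statement's English description precedes it below -/
import Mathlib

section
/- Let m ≥ 2 be even and let S = {(α,β) ∈ 𝔽_{q^m} × 𝔽_{q^m} : exactly one of α, β is zero, and the nonzero member γ of the pair satisfies Tr(γ²) ≠ 0}. Then #S = 2(q−1)(q^{m−1} − ε·q^{(m−2)/2}), and every (α,β) ∈ S satisfies W(α,β) = 2(q−1)q^{2m−3} + 2ε(q−1)(2q−1)q^{(3m−6)/2} + 2(q−1)²q^{m−2} (an equality of integers, with ε = ±1 as defined). -/
open Finset

/-- The defining set `D = {(a,b) ≠ (0,0) : Tr(a²) = 0 and Tr(b²) = 0}`. -/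
noncomputable def defSet (q : ℕ) (F : Type*) [Field F] [Fintype F] [DecidableEq F]
    [Algebra (ZMod q) F] : Finset (F × F) :=
  Finset.univ.filter (fun p : F × F => p ≠ (0, 0) ∧
    Algebra.trace (ZMod q) F (p.1 ^ 2) = 0 ∧ Algebra.trace (ZMod q) F (p.2 ^ 2) = 0)

/-- The Lee weight `W(α,β)` of the codeword of `C_D` corresponding to `x = α + uβ`,
i.e. the Hamming weight of its Gray image. -/
noncomputable def leeW (q : ℕ) (F : Type*) [Field F] [Fintype F] [DecidableEq F]
    [Algebra (ZMod q) F] (α β : F) : ℕ :=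
  ((defSet q F).filter
      (fun p => Algebra.trace (ZMod q) F (α * p.1 + β * p.2) ≠ 0)).card +
  ((defSet q F).filter
      (fun p => Algebra.trace (ZMod q) F (β * p.1 + α * p.2) ≠ 0)).card

/-- For even `m`, the sign `ε = −(−1)^{((q−1)²m)/8}`, so that the quadratic Gauss sum
over `𝔽_{q^m}` equals `ε·q^{m/2}`. -/
def epsEven (q m : ℕ) : ℤ := -(-1 : ℤ) ^ ((q - 1) ^ 2 * m / 8)

theorem card_fiber_mul_card {G H : Type*} [AddGroup G] [Fintype G] [AddGroup H] [Fintype H]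
    [DecidableEq H] (f : G →+ H) (hf : Function.Surjective f) (h : H) :
    #{x | f x = h} * Fintype.card H = Fintype.card G := by
  have key : ∀ c ∈ (univ : Finset H), #{x | f x = c} = #{x | f x = h} := fun c _ =>
    AddMonoidHom.card_fiber_eq_of_mem_range f (hf c) (hf h)
  rw [← Finset.card_univ (α := G),
    Finset.card_eq_sum_card_fiberwise (s := univ) (f := f) (t := univ)
      (fun _ _ => mem_coe.2 (mem_univ _)), Finset.sum_congr rfl key, sum_const,
    card_univ, smul_eq_mul, mul_comm]

theorem FiniteField.isSquare_algebraMap {K F : Type*} [Field K] [Fintype K] [Field F] [Fintype F]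
    [Algebra K F] (hK : Odd (Fintype.card K)) {j : ℕ}
    (hF : Fintype.card F = Fintype.card K ^ (2 * j)) (c : K) : IsSquare (algebraMap K F c) := by
  rcases eq_or_ne c 0 with rfl | hc
  · simp
  have hodd : Odd (Fintype.card F) := hF ▸ hK.pow
  have hchar : ringChar F ≠ 2 := fun h => by
    have := FiniteField.even_card_iff_char_two.1 h
    rw [Nat.odd_iff] at hodd; omega
  rw [FiniteField.isSquare_iff hchar (by simpa using hc)]
  have hdvd : Fintype.card K - 1 ∣ Fintype.card F / 2 := by
    obtain ⟨t, ht⟩ := hK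
    have h1 : (Fintype.card K ^ 2 - 1 ^ 2) ∣ ((Fintype.card K ^ 2) ^ j - (1 ^ 2) ^ j) :=
      Nat.sub_dvd_pow_sub_pow _ _ j
    rw [← pow_mul, ← hF, ht] at h1
    obtain ⟨d, hd⟩ := h1
    have h2 : (2 * t + 1) ^ 2 - 1 ^ 2 = 2 * (2 * t * (t + 1)) := by
      rw [Nat.sq_sub_sq, Nat.add_sub_cancel]; ring
    have h3 : Fintype.card F / 2 = 2 * t * ((t + 1) * d) := by
      rw [h2] at hd
      simp only [one_pow, mul_assoc] at hd ⊢
      obtain ⟨s, hs⟩ := hodd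
      omega
    rw [ht, h3]
    exact ⟨(t + 1) * d, by simp⟩
  obtain ⟨d, hd⟩ := hdvd
  rw [← map_pow, hd, pow_mul, FiniteField.pow_card_sub_one_eq_one c hc, one_pow, map_one]

section
variable {K F : Type*} [Field K] [DecidableEq K] [Field F] [Fintype F] [Algebra K F]

theorem card_trace_sq_eq_of_ne_zero (hsq : ∀ c : K, IsSquare (algebraMap K F c)) {c : K}
    (hc : c ≠ 0) :
    #{x : F | Algebra.trace K F (x ^ 2) = c} = #{x : F | Algebra.trace K F (x ^ 2) = 1} := by
  obtain ⟨y, hy⟩ := hsq c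
  have hy0 : y ≠ 0 := by
    rintro rfl
    simp [hc] at hy
  have htr : ∀ x : F, Algebra.trace K F ((y * x) ^ 2) = c * Algebra.trace K F (x ^ 2) := fun x => by
    rw [mul_pow, sq y, ← hy, ← Algebra.smul_def, map_smul, smul_eq_mul]
  symm
  refine card_bij' (fun x _ => y * x) (fun x _ => y⁻¹ * x) ?_ ?_ ?_ ?_
  · intro x hx
    simp only [mem_filter, mem_univ, true_and] at hx ⊢
    rw [htr, hx, mul_one]
  · intro x hx
    simp only [mem_filter, mem_univ, true_and] at hx ⊢
    have := htr (y⁻¹ * x)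
    rw [mul_inv_cancel_left₀ hy0, hx] at this
    exact mul_left_cancel₀ hc (by rw [← this, mul_one])
  · intro x _
    exact inv_mul_cancel_left₀ hy0 x
  · intro x _
    exact mul_inv_cancel_left₀ hy0 x

theorem card_trace_sq_mem (hsq : ∀ c : K, IsSquare (algebraMap K F c)) (t : Finset K)
    (ht : (0 : K) ∈ t) :
    (#{x : F | Algebra.trace K F (x ^ 2) ∈ t} : ℤ) =
      #{x : F | Algebra.trace K F (x ^ 2) = 0} +
        ((#t : ℤ) - 1) * #{x : F | Algebra.trace K F (x ^ 2) = 1} := by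
  rw [Finset.card_eq_sum_card_fiberwise (f := fun x => Algebra.trace K F (x ^ 2)) (t := t)
    (fun x hx => by simpa using hx), ← Finset.add_sum_erase _ _ ht]
  have h1 : ∀ c ∈ t, #{x ∈ {x : F | Algebra.trace K F (x ^ 2) ∈ t} |
      Algebra.trace K F (x ^ 2) = c} = #{x : F | Algebra.trace K F (x ^ 2) = c} := fun c hc => by
    congr 1
    ext x
    simp only [mem_filter, mem_univ, true_and, and_iff_right_iff_imp]
    rintro rfl
    exact hc
  rw [h1 0 ht, Finset.sum_congr rfl fun c hc =>
    (h1 c (mem_of_mem_erase hc)).trans (card_trace_sq_eq_of_ne_zero hsq (ne_of_mem_erase hc)),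
    sum_const, card_erase_of_mem ht, smul_eq_mul, Nat.cast_add, Nat.cast_mul,
    Nat.cast_sub (card_pos.2 ⟨0, ht⟩), Nat.cast_one]

theorem card_pairs_mul_eq [Fintype K] (d : K) :
    (#{p : K × K | p.1 * p.2 = d} : ℤ) =
      Fintype.card K - 1 + if d = 0 then (Fintype.card K : ℤ) else 0 := by
  have h : ∀ u : K, (#{v : K | u * v = d} : ℤ) =
      if u = 0 then (if d = 0 then (Fintype.card K : ℤ) else 0) else 1 := by
    intro u
    split_ifs with hu hd
    · subst hu hd; simp [Finset.card_univ]
    · subst hu; simp [Ne.symm hd]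
    · have : ({v : K | u * v = d} : Finset K) = {u⁻¹ * d} := by
        ext v
        simp [eq_inv_mul_iff_mul_eq₀ hu]
      simp [this]
  rw [← Finset.univ_product_univ, Finset.card_filter, Finset.sum_product, Nat.cast_sum]
  simp_rw [← Finset.card_filter, h]
  rw [← Finset.add_sum_erase _ _ (mem_univ (0 : K)), if_pos rfl,
    Finset.sum_congr rfl fun u hu => if_neg (ne_of_mem_erase hu)]
  rw [sum_const, card_erase_of_mem (mem_univ _), card_univ, nsmul_eq_mul,
    Nat.cast_sub Fintype.card_pos]
  push_cast
  ring

/-- The number of zeros of `x ↦ Tr(x²)` on the hyperplane `γ^⊥`, for `γ` anisotropic. -/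
theorem card_trace_sq_eq_zero_orthogonal [Fintype K] (h2 : (2 : K) ≠ 0)
    (hsq : ∀ c : K, IsSquare (algebraMap K F c)) {γ : F} (hγ : Algebra.trace K F (γ ^ 2) ≠ 0) :
    (Fintype.card K : ℤ) ^ 2 *
      #{x : F | Algebra.trace K F (x ^ 2) = 0 ∧ Algebra.trace K F (γ * x) = 0} =
      Fintype.card F := by
  set δ := Algebra.trace K F (γ ^ 2) with hδ
  let L : F →ₗ[K] K := Algebra.trace K F ∘ₗ LinearMap.mulLeft K γ
  have hL : ∀ x, L x = Algebra.trace K F (γ * x) := fun x => rfl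
  have hLγ : L γ = δ := by rw [hL, hδ, sq]
  have hLsurj : Function.Surjective L := fun c => ⟨(c / δ) • γ, by
    rw [map_smul, hLγ, smul_eq_mul, div_mul_cancel₀ _ hγ]⟩
  have hH : (#{x : F | L x = 0} : ℤ) * Fintype.card K = Fintype.card F := by
    exact_mod_cast card_fiber_mul_card L.toAddMonoidHom hLsurj 0
  have htr : ∀ (x : F) (t : K), Algebra.trace K F ((x + t • γ) ^ 2) =
      Algebra.trace K F (x ^ 2) + 2 * t * L x + t ^ 2 * δ := fun x t => by
    have : (x + t • γ) ^ 2 = x ^ 2 + (2 * t) • (γ * x) + t ^ 2 • γ ^ 2 := by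
      simp only [Algebra.smul_def, map_mul, map_pow, map_ofNat]
      ring
    rw [this, map_add, map_add, map_smul, map_smul, smul_eq_mul, smul_eq_mul]
    rfl
  have hcone : (#{p : K × F | Algebra.trace K F (p.2 ^ 2) = δ * p.1 ^ 2} : ℤ) =
      Fintype.card F := by
    rw [← Finset.univ_product_univ, Finset.card_filter, Finset.sum_product, Nat.cast_sum]
    simp_rw [← Finset.card_filter]
    rw [← Finset.add_sum_erase _ _ (mem_univ (0 : K)),
      Finset.sum_congr rfl fun s hs => by
        rw [card_trace_sq_eq_of_ne_zero hsq (mul_ne_zero hγ (pow_ne_zero 2 (ne_of_mem_erase hs)))]]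
    have := card_trace_sq_mem (F := F) hsq univ (mem_univ _)
    simp only [mem_univ, filter_true, card_univ] at this
    rw [this, sum_const, card_erase_of_mem (mem_univ _), card_univ, nsmul_eq_mul,
      Nat.cast_sub Fintype.card_pos]
    simp
  have hbij : #{p : F × K × K | L p.1 = 0 ∧ p.2.1 * p.2.2 = Algebra.trace K F (p.1 ^ 2) / δ} =
      #{p : K × F | Algebra.trace K F (p.2 ^ 2) = δ * p.1 ^ 2} := by
    refine card_bij' (fun p _ => ((p.2.1 + p.2.2) / 2, p.1 + ((p.2.1 - p.2.2) / 2) • γ))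
      (fun p _ => (p.2 - (L p.2 / δ) • γ, p.1 + L p.2 / δ, p.1 - L p.2 / δ)) ?_ ?_ ?_ ?_
    · rintro ⟨w, u, v⟩ h
      simp only [mem_filter, mem_univ, true_and] at h ⊢
      obtain ⟨h, h'⟩ := h
      rw [eq_div_iff hγ] at h'
      rw [htr, h, ← h']
      field_simp
      ring
    · rintro ⟨s, b⟩ h
      simp only [mem_filter, mem_univ, true_and] at h ⊢
      refine ⟨by rw [map_sub, map_smul, hLγ, smul_eq_mul, div_mul_cancel₀ _ hγ, sub_self], ?_⟩
      rw [sub_eq_add_neg b, ← neg_smul, htr, h]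
      field_simp
      ring
    · rintro ⟨w, u, v⟩ h
      simp only [mem_filter, mem_univ, true_and] at h
      have ht : L (w + ((u - v) / 2) • γ) / δ = (u - v) / 2 := by
        rw [map_add, map_smul, h.1, hLγ, zero_add, smul_eq_mul, mul_div_cancel_right₀ _ hγ]
      simp only [ht, Prod.mk.injEq, add_sub_cancel_right, true_and]
      constructor <;> field_simp <;> ring
    · rintro ⟨s, b⟩ h
      simp only [Prod.mk.injEq]
      constructor
      · field_simp; ring
      · have : (s + L b / δ - (s - L b / δ)) / 2 = L b / δ := by field_simp; ring
        rw [this, sub_add_cancel]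
  have hcount : (#{p : F × K × K | L p.1 = 0 ∧
      p.2.1 * p.2.2 = Algebra.trace K F (p.1 ^ 2) / δ} : ℤ) =
      #{x : F | L x = 0} * (Fintype.card K - 1) +
      #{x : F | Algebra.trace K F (x ^ 2) = 0 ∧ L x = 0} * Fintype.card K := by
    have : ∀ x : F, (#{y : K × K | L x = 0 ∧ y.1 * y.2 = Algebra.trace K F (x ^ 2) / δ} : ℤ) =
        (if L x = 0 then ((Fintype.card K : ℤ) - 1) else 0) +
          if Algebra.trace K F (x ^ 2) = 0 ∧ L x = 0 then (Fintype.card K : ℤ) else 0 := fun x => by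
      by_cases hx : L x = 0
      · simp only [hx, true_and, if_true, card_pairs_mul_eq, div_eq_zero_iff, hγ, or_false, and_true]
      · simp [hx]
    rw [← Finset.univ_product_univ, Finset.card_filter, Finset.sum_product, Nat.cast_sum]
    simp_rw [← Finset.card_filter, this]
    rw [sum_add_distrib, ← sum_filter, ← sum_filter, sum_const, sum_const, nsmul_eq_mul,
      nsmul_eq_mul]
  rw [hbij, hcone] at hcount
  simp only [← hL]
  linear_combination -(Fintype.card K : ℤ) * hcount - ((Fintype.card K : ℤ) - 1) * hH
end

theorem FiniteField.exists_isPrimitiveRoot_card_sub_one (F : Type*) [Field F] [Fintype F] :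
    ∃ g : F, IsPrimitiveRoot g (Fintype.card F - 1) := by
  classical
  obtain ⟨g, hg⟩ := IsCyclic.exists_generator (α := Fˣ)
  refine ⟨g, ?_⟩
  rw [IsPrimitiveRoot.coe_units_iff, ← Fintype.card_units, ← Nat.card_eq_fintype_card,
    ← orderOf_eq_card_of_forall_mem_zpowers hg]
  exact IsPrimitiveRoot.orderOf g

/-- Over a quadratic extension, the form `x ↦ Tr(x²)` is hyperbolic when `|K| ≡ 3 mod 4`
and anisotropic when `|K| ≡ 1 mod 4`. -/
theorem card_trace_sq_eq_zero_of_quadratic {K F : Type*} [Field K] [Fintype K] [DecidableEq K]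
    [Field F] [Fintype F] [Algebra K F] (hK : Odd (Fintype.card K))
    (hF : Fintype.card F = Fintype.card K ^ 2) :
    (#{x : F | Algebra.trace K F (x ^ 2) = 0} : ℤ) =
      Fintype.card K - (-1) ^ (Fintype.card K / 2) * ((Fintype.card K : ℤ) - 1) := by
  classical
  have hfin : Module.finrank K F = 2 := by
    have h := Module.card_eq_pow_finrank (K := K) (V := F)
    rw [hF] at h
    exact (Nat.pow_right_injective Fintype.one_lt_card h).symm
  have hne : (-1 : F) ≠ 1 := by
    refine Ring.neg_one_ne_one_of_char_ne_two fun h => ?_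
    have h1 := FiniteField.even_card_iff_char_two.1 h
    have h2 : Odd (Fintype.card F) := hF ▸ hK.pow
    rw [Nat.odd_iff] at h2
    omega
  have hr := Fintype.one_lt_card (α := K)
  set r := Fintype.card K with hrdef
  have htr : ∀ x : F, Algebra.trace K F (x ^ 2) = 0 ↔ x = 0 ∨ x ^ (2 * (r - 1)) = -1 := fun x => by
    have h2r : 2 * r = 2 * (r - 1) + 2 := by omega
    rw [← (algebraMap K F).injective.eq_iff, map_zero, FiniteField.algebraMap_trace_eq_sum_pow,
      hfin, Finset.sum_range_succ, Finset.sum_range_one, pow_zero, pow_one, pow_one,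
      Nat.card_eq_fintype_card, ← hrdef, ← pow_mul, h2r, pow_add,
      show x ^ 2 + x ^ (2 * (r - 1)) * x ^ 2 = x ^ 2 * (x ^ (2 * (r - 1)) + 1) by ring,
      mul_eq_zero, pow_eq_zero_iff two_ne_zero, add_eq_zero_iff_eq_neg]
  have hsplit : (#{x : F | Algebra.trace K F (x ^ 2) = 0} : ℤ) =
      1 + #{x : F | x ^ (2 * (r - 1)) = -1} := by
    have : ({x : F | Algebra.trace K F (x ^ 2) = 0} : Finset F) =
        insert 0 ({x : F | x ^ (2 * (r - 1)) = -1} : Finset F) := by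
      ext x
      simp [htr]
    rw [this, card_insert_of_notMem, Nat.cast_add, Nat.cast_one, add_comm]
    simp [zero_pow (show 2 * (r - 1) ≠ 0 by omega)]
  rw [hsplit]
  have hmod : r % 4 = 1 ∨ r % 4 = 3 := by
    rw [Nat.odd_iff] at hK
    omega
  rcases hmod with h | h
  · obtain ⟨t, ht⟩ : ∃ t, r = 4 * t + 1 := ⟨r / 4, by omega⟩
    have hempty : ({x : F | x ^ (2 * (r - 1)) = -1} : Finset F) = ∅ := by
      refine filter_eq_empty_iff.2 fun x _ hx => hne ?_
      have hx0 : x ≠ 0 := by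
        rintro rfl
        rw [zero_pow (by omega)] at hx
        simp at hx
      have h1 := FiniteField.pow_card_sub_one_eq_one x hx0
      have hexp : Fintype.card F - 1 = 2 * (r - 1) * (2 * t + 1) := by
        rw [hF, ht, Nat.add_sub_cancel]
        exact Nat.sub_eq_of_eq_add (by ring)
      rwa [hexp, pow_mul, hx, Odd.neg_one_pow ⟨t, rfl⟩] at h1
    rw [hempty, show r / 2 = 2 * t by omega, Even.neg_one_pow ⟨t, two_mul t⟩]
    simp
  · obtain ⟨t, ht⟩ : ∃ t, r = 4 * t + 3 := ⟨r / 4, by omega⟩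
    obtain ⟨g, hg⟩ := FiniteField.exists_isPrimitiveRoot_card_sub_one F
    have hexp : Fintype.card F - 1 = 2 * (t + 1) * (2 * (r - 1)) := by
      rw [hF, ht, show 4 * t + 3 - 1 = 4 * t + 2 by omega]
      exact Nat.sub_eq_of_eq_add (by ring)
    have hpos : 0 < Fintype.card F - 1 := Nat.sub_pos_of_lt Fintype.one_lt_card
    have hζ := hg.pow hpos hexp
    have hneg : (g ^ (t + 1)) ^ (2 * (r - 1)) = -1 := by
      rw [← pow_mul]
      exact (hg.pow hpos (by rw [hexp]; ring)).eq_neg_one_of_two_right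
    have hcard : #{x : F | x ^ (2 * (r - 1)) = -1} = 2 * (r - 1) := by
      have : ({x : F | x ^ (2 * (r - 1)) = -1} : Finset F) =
          (Polynomial.nthRoots (2 * (r - 1)) (-1 : F)).toFinset := by
        ext x
        simp [Polynomial.mem_nthRoots (show 0 < 2 * (r - 1) by omega)]
      rw [this, Multiset.toFinset_card_of_nodup (hζ.nthRoots_nodup (by simp)),
        hζ.card_nthRoots, if_pos ⟨_, hneg⟩]
    rw [hcard, show r / 2 = 2 * t + 1 by omega, Odd.neg_one_pow ⟨t, rfl⟩]
    push_cast [Nat.cast_sub hr.le]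
    ring

theorem epsEven_two_mul {q : ℕ} (hq : Odd q) (k : ℕ) :
    epsEven q (2 * k) = -(-1) ^ (q ^ k / 2) := by
  rw [epsEven, ← ZMod.χ₄_eq_neg_one_pow (Nat.odd_iff.1 hq.pow), Nat.cast_pow, map_pow,
    ZMod.χ₄_eq_neg_one_pow (Nat.odd_iff.1 hq), ← pow_mul]
  obtain ⟨s, rfl⟩ := hq
  rw [Nat.add_sub_cancel, show (2 * s) ^ 2 * (2 * k) = s * (s * k) * 8 by ring,
    Nat.mul_div_cancel _ (by norm_num), show (2 * s + 1) / 2 = s by omega, pow_mul, pow_mul,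
    pow_mul]
  rcases neg_one_pow_eq_or ℤ s with h | h
  · simp [h]
  · rw [h, h]

theorem card_trace_sq_eq_zero_even {q k : ℕ} [Fact q.Prime] (hq : Odd q) (hk : k ≠ 0)
    {F : Type*} [Field F] [Fintype F] [Algebra (ZMod q) F]
    (hF : Fintype.card F = q ^ (2 * k)) :
    (q : ℤ) * #{x : F | Algebra.trace (ZMod q) F (x ^ 2) = 0} =
      (q : ℤ) ^ (2 * k) + epsEven q (2 * k) * ((q : ℤ) - 1) * (q : ℤ) ^ k := by
  classical
  have hfin : Module.finrank (ZMod q) F = 2 * k := by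
    have h := Module.card_eq_pow_finrank (K := ZMod q) (V := F)
    rw [hF, ZMod.card] at h
    exact (Nat.pow_right_injective (Fact.out : q.Prime).two_le h).symm
  let K := GaloisField q k
  let _ : Fintype K := Fintype.ofFinite K
  have hK : Fintype.card K = q ^ k := by
    rw [← Nat.card_eq_fintype_card]
    exact GaloisField.card q k hk
  obtain ⟨f⟩ : Nonempty (K →ₐ[ZMod q] F) := FiniteField.nonempty_algHom_of_finrank_dvd (by
    rw [hfin, GaloisField.finrank q hk]
    exact dvd_mul_left _ _)
  let _ : Algebra K F := f.toRingHom.toAlgebra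
  have : IsScalarTower (ZMod q) K F := IsScalarTower.of_algHom f
  have hFK : Fintype.card F = Fintype.card K ^ 2 := by rw [hF, hK, ← pow_mul, mul_comm]
  have hKodd : Odd (Fintype.card K) := hK ▸ hq.pow
  have hsq : ∀ c : K, IsSquare (algebraMap K F c) :=
    FiniteField.isSquare_algebraMap hKodd (j := 1) hFK
  let t : Finset K := {c | Algebra.trace (ZMod q) K c = 0}
  have ht0 : (0 : K) ∈ t := by simp [t]
  have ht : (#t : ℤ) * q = q ^ k := by
    have := card_fiber_mul_card (Algebra.trace (ZMod q) K).toAddMonoidHom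
      (Algebra.trace_surjective (ZMod q) K) 0
    rw [ZMod.card, hK] at this
    exact_mod_cast this
  have hmem : #{x : F | Algebra.trace (ZMod q) F (x ^ 2) = 0} =
      #{x : F | Algebra.trace K F (x ^ 2) ∈ t} := by
    congr 1
    ext x
    simp [t, Algebra.trace_trace]
  have hall := card_trace_sq_mem (F := F) hsq univ (mem_univ _)
  simp only [mem_univ, filter_true, card_univ, hF, hK] at hall
  have h0 := card_trace_sq_eq_zero_of_quadratic hKodd hFK
  rw [hK] at h0
  rw [hmem, card_trace_sq_mem hsq t ht0, epsEven_two_mul hq]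
  have hr : ((q : ℤ) ^ k - 1) ≠ 0 := by
    have : 1 < q ^ k := Nat.one_lt_pow hk (Fact.out : q.Prime).one_lt
    have : (1 : ℤ) < (q : ℤ) ^ k := by exact_mod_cast this
    omega
  push_cast at hall h0
  have h1 : (#{x : F | Algebra.trace K F (x ^ 2) = 1} : ℤ) = q ^ k + (-1) ^ (q ^ k / 2) := by
    apply mul_left_cancel₀ hr
    rw [h0, mul_comm 2 k, pow_mul] at hall
    linear_combination -hall
  rw [h0, h1, mul_comm 2 k, pow_mul]
  linear_combination ((q : ℤ) ^ k + (-1) ^ (q ^ k / 2)) * ht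

section
variable (q : ℕ) (F : Type*) [Field F] [Fintype F] [DecidableEq F] [Algebra (ZMod q) F]

theorem leeW_comm (α β : F) : leeW q F α β = leeW q F β α :=
  Nat.add_comm _ _

theorem leeW_zero_left (γ : F) :
    leeW q F 0 γ = 2 * (#{x : F | Algebra.trace (ZMod q) F (x ^ 2) = 0} *
      #{x : F | Algebra.trace (ZMod q) F (x ^ 2) = 0 ∧
        Algebra.trace (ZMod q) F (γ * x) ≠ 0}) := by
  have h1 : (defSet q F).filter (fun p => Algebra.trace (ZMod q) F (0 * p.1 + γ * p.2) ≠ 0) =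
      ({x : F | Algebra.trace (ZMod q) F (x ^ 2) = 0} : Finset F) ×ˢ
      ({x : F | Algebra.trace (ZMod q) F (x ^ 2) = 0 ∧
        Algebra.trace (ZMod q) F (γ * x) ≠ 0} : Finset F) := by
    ext ⟨a, b⟩
    simp only [defSet, mem_filter, mem_univ, true_and, mem_product, zero_mul, zero_add]
    refine ⟨fun h => ⟨h.1.2.1, h.1.2.2, h.2⟩, fun h => ⟨⟨?_, h.1, h.2.1⟩, h.2.2⟩⟩
    rintro ⟨⟩
    simp at h
  have h2 : (defSet q F).filter (fun p => Algebra.trace (ZMod q) F (γ * p.1 + 0 * p.2) ≠ 0) =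
      ({x : F | Algebra.trace (ZMod q) F (x ^ 2) = 0 ∧
        Algebra.trace (ZMod q) F (γ * x) ≠ 0} : Finset F) ×ˢ
      ({x : F | Algebra.trace (ZMod q) F (x ^ 2) = 0} : Finset F) := by
    ext ⟨a, b⟩
    simp only [defSet, mem_filter, mem_univ, true_and, mem_product, zero_mul, add_zero]
    refine ⟨fun h => ⟨⟨h.1.2.1, h.2⟩, h.1.2.2⟩, fun h => ⟨⟨?_, h.1.1, h.2⟩, h.1.2⟩⟩
    rintro ⟨⟩
    simp at h
  rw [leeW, h1, h2, card_product, card_product]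
  ring

end

theorem stmt14 (q m : ℕ) [Fact q.Prime] (hq : Odd q) (hm : 2 ≤ m) (hmeven : Even m)
    (F : Type*) [Field F] [Fintype F] [DecidableEq F] [Algebra (ZMod q) F]
    (hF : Fintype.card F = q ^ m)
    (S : Finset (F × F))
    (hS : S = Finset.univ.filter (fun p : F × F =>
      (p.1 = 0 ∧ p.2 ≠ 0 ∧ Algebra.trace (ZMod q) F (p.2 ^ 2) ≠ 0) ∨
      (p.1 ≠ 0 ∧ p.2 = 0 ∧ Algebra.trace (ZMod q) F (p.1 ^ 2) ≠ 0))) :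
    (S.card : ℤ) = 2 * ((q : ℤ) - 1) *
        ((q : ℤ) ^ (m - 1) - epsEven q m * (q : ℤ) ^ ((m - 2) / 2)) ∧
    ∀ p ∈ S, (leeW q F p.1 p.2 : ℤ) =
      2 * ((q : ℤ) - 1) * (q : ℤ) ^ (2 * m - 3) +
        2 * epsEven q m * ((q : ℤ) - 1) * (2 * (q : ℤ) - 1) * (q : ℤ) ^ ((3 * m - 6) / 2) +
        2 * ((q : ℤ) - 1) ^ 2 * (q : ℤ) ^ (m - 2) := by
  obtain ⟨k, rfl⟩ := hmeven
  obtain ⟨j, rfl⟩ : ∃ j, k = j + 1 := ⟨k - 1, by omega⟩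
  have h2m : j + 1 + (j + 1) = 2 * (j + 1) := by ring
  rw [h2m] at hF ⊢
  set ε := epsEven q (2 * (j + 1)) with hε
  have hεsq : ε ^ 2 = 1 := by
    rw [hε, epsEven, neg_sq, ← pow_mul, mul_comm, pow_mul, neg_one_sq, one_pow]
  have hq0 : (q : ℤ) ≠ 0 := by exact_mod_cast (Fact.out : q.Prime).ne_zero
  have h2 : (2 : ZMod q) ≠ 0 := by
    refine Ring.two_ne_zero ?_
    rw [ZMod.ringChar_zmod_n]
    rintro rfl
    exact absurd hq (by decide)
  have hsq : ∀ c : ZMod q, IsSquare (algebraMap (ZMod q) F c) :=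
    FiniteField.isSquare_algebraMap (by rwa [ZMod.card]) (by rw [hF, ZMod.card])
  have hN : (#{x : F | Algebra.trace (ZMod q) F (x ^ 2) = 0} : ℤ) =
      q ^ (2 * j + 1) + ε * (q - 1) * q ^ j := by
    apply mul_left_cancel₀ hq0
    rw [card_trace_sq_eq_zero_even (k := j + 1) hq (Nat.succ_ne_zero j) hF, ← hε]
    ring
  have hM : ∀ γ : F, Algebra.trace (ZMod q) F (γ ^ 2) ≠ 0 →
      (#{x : F | Algebra.trace (ZMod q) F (x ^ 2) = 0 ∧
        Algebra.trace (ZMod q) F (γ * x) ≠ 0} : ℤ) =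
      q ^ (2 * j + 1) + ε * (q - 1) * q ^ j - q ^ (2 * j) := fun γ hγ => by
    have h := card_trace_sq_eq_zero_orthogonal h2 hsq hγ
    rw [ZMod.card, hF] at h
    have h0 : (#{x : F | Algebra.trace (ZMod q) F (x ^ 2) = 0 ∧
        Algebra.trace (ZMod q) F (γ * x) = 0} : ℤ) = q ^ (2 * j) := by
      apply mul_left_cancel₀ (pow_ne_zero 2 hq0)
      rw [h]
      push_cast
      ring
    rw [← hN, ← h0, eq_sub_iff_add_eq', ← filter_filter, ← filter_filter]
    exact_mod_cast card_filter_add_card_filter_not _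
  have hne : ∀ x : F, Algebra.trace (ZMod q) F (x ^ 2) ≠ 0 → x ≠ 0 := by
    rintro x hx rfl
    simp at hx
  constructor
  · have hT : (#{x : F | Algebra.trace (ZMod q) F (x ^ 2) ≠ 0} : ℤ) =
        q ^ (2 * (j + 1)) - (q ^ (2 * j + 1) + ε * (q - 1) * q ^ j) := by
      rw [← hN, eq_sub_iff_add_eq', ← Nat.cast_pow, ← hF, ← Finset.card_univ]
      exact_mod_cast card_filter_add_card_filter_not _
    set T : Finset F := {x : F | Algebra.trace (ZMod q) F (x ^ 2) ≠ 0} with hTdef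
    have hSunion : S = ({0} ×ˢ T) ∪ (T ×ˢ {0}) := by
      ext ⟨a, b⟩
      simp only [hS, hTdef, mem_filter, mem_univ, true_and, mem_union, mem_product, mem_singleton]
      have ha := hne a
      have hb := hne b
      tauto
    have hdisj : Disjoint (({0} : Finset F) ×ˢ T) (T ×ˢ {0}) := by
      refine disjoint_left.2 ?_
      rintro ⟨a, b⟩ h h'
      simp only [mem_product, mem_singleton] at h h'
      exact hne a (mem_filter.1 h'.1).2 h.1
    rw [hSunion, card_union_of_disjoint hdisj, card_product, card_product, card_singleton,
      one_mul, mul_one, Nat.cast_add, hT, show 2 * (j + 1) - 1 = 2 * j + 1 by omega,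
      show (2 * (j + 1) - 2) / 2 = j by omega]
    ring
  · have hW : ∀ γ : F, Algebra.trace (ZMod q) F (γ ^ 2) ≠ 0 → (leeW q F 0 γ : ℤ) =
        2 * ((q : ℤ) - 1) * (q : ℤ) ^ (2 * (2 * (j + 1)) - 3) +
        2 * ε * ((q : ℤ) - 1) * (2 * (q : ℤ) - 1) * (q : ℤ) ^ ((3 * (2 * (j + 1)) - 6) / 2) +
        2 * ((q : ℤ) - 1) ^ 2 * (q : ℤ) ^ (2 * (j + 1) - 2) := fun γ hγ => by
      rw [leeW_zero_left, Nat.cast_mul, Nat.cast_mul, hN, hM γ hγ,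
        show 2 * (2 * (j + 1)) - 3 = 4 * j + 1 by omega,
        show (3 * (2 * (j + 1)) - 6) / 2 = 3 * j by omega,
        show 2 * (j + 1) - 2 = 2 * j by omega]
      push_cast
      linear_combination 2 * ((q : ℤ) - 1) ^ 2 * (q : ℤ) ^ (2 * j) * hεsq
    rintro ⟨a, b⟩ hp
    rw [hS, mem_filter] at hp
    rcases hp.2 with ⟨ha, -, hb⟩ | ⟨-, hb, ha⟩
    · dsimp only at ha hb ⊢
      rw [ha]
      exact hW b hb
    · dsimp only at ha hb ⊢
      rw [hb, leeW_comm]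
      exact hW a ha
end

section
/- Let m ≥ 2 be even and let S = {(α,β) ∈ 𝔽_{q^m} × 𝔽_{q^m} : α ≠ 0, β ≠ 0, and exactly one of Tr(α²), Tr(β²) equals 0}. Then #S = 2(q−1)(q^{m−1} − ε·q^{(m−2)/2})(q^{m−1} + ε(q−1)q^{(m−2)/2} − 1), and every (α,β) ∈ S satisfies W(α,β) = 2(q−1)q^{2m−3} + 4ε(q−1)²q^{(3m−6)/2} + 2(q−1)²q^{m−2} (an equality of integers, with ε = ±1 as defined). -/
open Finset

theorem sum_addChar_mul_sq {K : Type*} [Field K] [Fintype K] [DecidableEq K]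
    (hK : ringChar K ≠ 2) {ψ : AddChar K ℂ} (hψ : ψ.IsPrimitive) {a : K} (ha : a ≠ 0) :
    ∑ x : K, ψ (a * x ^ 2) = (quadraticChar K a : ℂ) *
      gaussSum ((quadraticChar K).ringHomComp (Int.castRingHom ℂ)) ψ := by
  have h1 : ∑ x : K, ψ (a * x ^ 2) = ∑ t : K, ((quadraticChar K t : ℂ) + 1) * ψ (a * t) := by
    rw [← Finset.sum_fiberwise_of_maps_to (s := univ) (t := univ) (g := fun x : K => x ^ 2)
      (fun _ _ => mem_univ _)]
    refine Finset.sum_congr rfl fun t _ => ?_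
    rw [Finset.sum_congr rfl (g := fun _ => ψ (a * t))
      (fun x hx => by rw [(mem_filter.1 hx).2]), sum_const, nsmul_eq_mul]
    congr 1
    have := quadraticChar_card_sqrts hK t
    rw [Set.toFinset_ofPred] at this
    exact_mod_cast congrArg (Int.cast : ℤ → ℂ) this
  have h2 : ∑ t : K, ψ (a * t) = 0 := by
    have := AddChar.sum_mulShift a hψ
    simp only [ha, if_false] at this
    simpa [mul_comm] using this
  have h3 := gaussSum_mulShift ((quadraticChar K).ringHomComp (Int.castRingHom ℂ)) ψ (Units.mk0 a ha)
  have h4 : (quadraticChar K a : ℂ) * quadraticChar K a = 1 := by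
    have := quadraticChar_sq_one ha
    rw [← sq]; exact_mod_cast this
  simp only [Units.val_mk0, MulChar.ringHomComp_apply, eq_intCast] at h3
  rw [h1, ← h3, ← mul_assoc, h4, one_mul, gaussSum]
  simp only [add_mul, sum_add_distrib, one_mul, h2, add_zero, AddChar.mulShift_apply,
    MulChar.ringHomComp_apply, eq_intCast]

theorem not_isSquare_discr_of_even {K L : Type*} [Field K] [Field L] [Finite L] [Algebra K L]
    (hL : ringChar K ≠ 2) {n : ℕ} (hn : 0 < n) (hev : Even n) (b : Module.Basis (Fin n) K L) :
    ¬ IsSquare (Algebra.discr K b) := by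
  have : Finite K := Finite.of_injective _ (FaithfulSMul.algebraMap_injective K L)
  have := Fintype.ofFinite K
  have hfin : Module.finrank K L = n := by simpa using Module.finrank_eq_card_basis b
  let φ := FiniteField.frobeniusAlgEquivOfAlgebraic K L
  let M : Matrix (Fin n) (Fin n) L := Matrix.of fun i j => (φ ^ (i : ℕ)) (b j)
  have hφn : φ ^ n = 1 := by
    rw [← hfin, ← FiniteField.orderOf_frobeniusAlgEquivOfAlgebraic, pow_orderOf_eq_one]
  have hM : algebraMap K L (Algebra.discr K b) = M.det ^ 2 := by
    rw [Algebra.discr_def, RingHom.map_det, sq]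
    nth_rewrite 1 [← Matrix.det_transpose M]
    rw [← Matrix.det_mul]
    congr 1
    ext i j
    simp only [RingHom.mapMatrix_apply, Matrix.map_apply, Algebra.traceMatrix_apply,
      Algebra.traceForm_apply, FiniteField.algebraMap_trace_eq_sum_pow, Matrix.mul_apply,
      Matrix.transpose_apply, hfin, Finset.sum_range, M, Matrix.of_apply, ← map_mul]
    refine Finset.sum_congr rfl fun k _ => ?_
    rw [AlgEquiv.coe_pow, FiniteField.coe_frobeniusAlgEquivOfAlgebraic_iterate,
      Fintype.card_eq_nat_card]
  have hrot : φ M.det = - M.det := by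
    have h1 : φ M.det = (M.submatrix (finRotate n) id).det := by
      change φ.toRingEquiv.toRingHom M.det = _
      rw [RingHom.map_det]
      congr 1
      ext i j
      obtain ⟨k, rfl⟩ : ∃ k, n = k + 1 := ⟨n - 1, by omega⟩
      simp only [RingHom.mapMatrix_apply, Matrix.map_apply, Matrix.submatrix_apply, id, M,
        Matrix.of_apply, coe_finRotate]
      change φ ((φ ^ (i : ℕ)) (b j)) = _
      rw [← AlgEquiv.mul_apply, ← pow_succ']
      split_ifs with h
      · rw [h, Fin.val_last, hφn, pow_zero]
      · rfl
    rw [h1, Matrix.det_permute, sign_finRotate, (Nat.Even.sub_odd hn hev odd_one).neg_one_pow]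
    simp
  rintro ⟨c, hc⟩
  have h0 := Algebra.discr_not_zero_of_basis K b
  rw [hc, map_mul, ← sq] at hM
  have hfix : φ M.det = M.det := by
    rcases sq_eq_sq_iff_eq_or_eq_neg.1 hM with h | h
    · rw [← h, AlgEquiv.commutes]
    · rw [← neg_eq_iff_eq_neg.2 h, map_neg, AlgEquiv.commutes]
  have h2 : (2 : L) ≠ 0 := by
    rw [← map_ofNat (algebraMap K L) 2]
    exact (map_ne_zero _).2 (Ring.two_ne_zero hL)
  have hdet : M.det = 0 := by
    have : 2 * M.det = 0 := by linear_combination (hfix.symm.trans hrot)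
    exact (mul_eq_zero.1 this).resolve_left h2
  rw [hdet] at hM
  have hc0 : c = 0 := by simpa using hM
  exact h0 (by rw [hc, hc0, mul_zero])

theorem card_mul_card_filter_trace {K L : Type*} [Field K] [Fintype K] [DecidableEq K] [Field L]
    [Algebra K L] {ψ : AddChar K ℂ} (hψ : ψ.IsPrimitive) (Z : Finset L) (α β : L) :
    (Fintype.card K : ℂ) *
        ((Z ×ˢ Z).filter fun p => Algebra.trace K L (α * p.1 + β * p.2) = 0).card =
      ∑ z : K, (∑ a ∈ Z, ψ (Algebra.trace K L (z • α * a))) *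
        ∑ b ∈ Z, ψ (Algebra.trace K L (z • β * b)) := by
  have h : ∀ z : K, (∑ a ∈ Z, ψ (Algebra.trace K L (z • α * a))) *
      ∑ b ∈ Z, ψ (Algebra.trace K L (z • β * b)) =
      ∑ p ∈ Z ×ˢ Z, ψ (z * Algebra.trace K L (α * p.1 + β * p.2)) := fun z => by
    rw [Finset.sum_mul_sum, Finset.sum_product]
    simp only [← AddChar.map_add_eq_mul, smul_mul_assoc, map_smul, smul_eq_mul, map_add, mul_add]
  simp only [h]
  rw [Finset.sum_comm, Finset.card_filter, Nat.cast_sum, Finset.mul_sum]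
  refine Finset.sum_congr rfl fun p _ => ?_
  rw [AddChar.sum_mulShift _ hψ]
  split_ifs <;> simp

section TraceSums

variable {K L : Type*} [Field K] [Fintype K] [Field L] [Fintype L] [Algebra K L]
  {ψ : AddChar K ℂ}

theorem sum_addChar_trace_mul (hψ : ψ.IsPrimitive) {γ : L} (hγ : γ ≠ 0) :
    ∑ a : L, ψ (Algebra.trace K L (γ * a)) = 0 := by
  let θ : AddChar L ℂ := ψ.compAddMonoidHom
    ((Algebra.trace K L).toAddMonoidHom.comp (AddMonoidHom.mulLeft γ))
  have hθ : θ ≠ 1 := by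
    intro h
    refine hψ one_ne_zero ?_
    ext s
    obtain ⟨x, rfl⟩ := Algebra.trace_surjective K L s
    have := DFunLike.congr_fun h (γ⁻¹ * x)
    simpa [θ, hγ] using this
  exact AddChar.sum_eq_zero_of_ne_one hθ

theorem sum_addChar_div (hψ : ψ.IsPrimitive) {c : K} (hc : c ≠ 0) :
    ∑ y : K, ψ (c / y) = 0 := by
  have hinv : Function.Involutive fun y : K => c / y := fun y => by
    simp [div_div_cancel₀, hc]
  rw [Fintype.sum_bijective _ hinv.bijective (fun y => ψ (c / y)) ψ fun _ => rfl]
  exact AddChar.sum_eq_zero_of_ne_one (by simpa using hψ one_ne_zero)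

variable [DecidableEq K]

theorem sum_addChar_trace_sq (hK : ringChar K ≠ 2) (hψ : ψ.IsPrimitive)
    (hev : Even (Module.finrank K L)) {y : K} (hy : y ≠ 0) :
    ∑ a : L, ψ (y * Algebra.trace K L (a ^ 2)) =
      -((quadraticChar K (-1) : ℂ) * Fintype.card K) ^ (Module.finrank K L / 2) := by
  have : Invertible (2 : K) := invertibleOfNonzero (Ring.two_ne_zero hK)
  set n := Module.finrank K L
  obtain ⟨v, hv⟩ := LinearMap.BilinForm.exists_orthogonal_basis
    (B := Algebra.traceForm K L) ⟨fun a b => congrArg (Algebra.trace K L) (mul_comm a b)⟩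
  have hn0 : 0 < n := Module.finrank_pos
  let w : Fin n → K := fun i => Algebra.trace K L (v i * v i)
  have hort : ∀ i j, i ≠ j → Algebra.trace K L (v i * v j) = 0 := fun i j hij => by
    rw [← Algebra.traceForm_apply]
    exact hv hij
  have hdisc : Algebra.discr K v = ∏ i, w i := by
    rw [Algebra.discr_def, ← Matrix.det_diagonal]
    congr 1
    ext i j
    rw [Algebra.traceMatrix_apply, Algebra.traceForm_apply, Matrix.diagonal_apply]
    split_ifs with h
    · rw [h]
    · exact hort i j h
  have hw : ∀ i, w i ≠ 0 := by
    have := Algebra.discr_not_zero_of_basis K v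
    rw [hdisc, Finset.prod_ne_zero_iff] at this
    exact fun i => this i (mem_univ i)
  have hχ : ∏ i, quadraticChar K (w i) = -1 := by
    rw [← map_prod, ← hdisc, quadraticChar_neg_one_iff_not_isSquare]
    exact not_isSquare_discr_of_even hK hn0 hev v
  have hexp : ∀ c : Fin n → K, Algebra.trace K L (v.equivFun.symm c ^ 2) = ∑ i, w i * c i ^ 2 := by
    intro c
    rw [Module.Basis.equivFun_symm_apply, sq, Finset.sum_mul_sum, map_sum]
    refine Finset.sum_congr rfl fun i _ => ?_
    rw [map_sum, Finset.sum_eq_single i]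
    · rw [smul_mul_smul_comm, map_smul, smul_eq_mul]; ring
    · intro j _ hj
      rw [smul_mul_smul_comm, map_smul, hort i j hj.symm, smul_zero]
    · simp
  rw [← v.equivFun.symm.toEquiv.sum_comp]
  simp only [LinearEquiv.coe_toEquiv, hexp]
  have hprod : ∀ c : Fin n → K, ψ (y * ∑ i, w i * c i ^ 2) = ∏ i, ψ (y * w i * c i ^ 2) := by
    intro c
    simp only [Finset.mul_sum, mul_assoc]
    exact map_prod ψ.toMonoidHom (fun i => Multiplicative.ofAdd (y * (w i * c i ^ 2))) univ
  simp only [hprod]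
  rw [← Fintype.piFinset_univ, ← Finset.prod_univ_sum (fun _ => univ) fun i t => ψ (y * w i * t ^ 2)]
  simp only [sum_addChar_mul_sq hK hψ (mul_ne_zero hy (hw _)), map_mul, Int.cast_mul,
    Finset.prod_mul_distrib, Finset.prod_const, card_univ, Fintype.card_fin]
  have hχ' : ∏ i, (quadraticChar K (w i) : ℂ) = -1 := by exact_mod_cast hχ
  obtain ⟨k, hk⟩ := hev
  have hnk : n = 2 * k := by omega
  have hy1 : (quadraticChar K y : ℂ) ^ 2 = 1 := by exact_mod_cast quadraticChar_sq_one hy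
  have hχ1 : (quadraticChar K).ringHomComp (Int.castRingHom ℂ) ≠ 1 := by
    rw [MulChar.ringHomComp_ne_one_iff Int.cast_injective]
    exact quadraticChar_ne_one hK
  rw [hχ', hnk, pow_mul, pow_mul, hy1, one_pow, gaussSum_sq hχ1
    ((quadraticChar_isQuadratic K).comp _) hψ, Nat.mul_div_cancel_left _ two_pos]
  simp

theorem sum_addChar_trace_sq_add (hK : ringChar K ≠ 2) (hψ : ψ.IsPrimitive)
    (hev : Even (Module.finrank K L)) {y : K} (hy : y ≠ 0) (γ : L) :
    ∑ a : L, ψ (y * Algebra.trace K L (a ^ 2) + Algebra.trace K L (γ * a)) =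
      ψ (-Algebra.trace K L (γ ^ 2) / 4 / y) *
        -((quadraticChar K (-1) : ℂ) * Fintype.card K) ^ (Module.finrank K L / 2) := by
  have h2 : (2 : K) ≠ 0 := Ring.two_ne_zero hK
  have h4 : (4 : K) ≠ 0 := by
    rw [show (4 : K) = 2 * 2 by norm_num]
    exact mul_ne_zero h2 h2
  rw [← sum_addChar_trace_sq (L := L) hK hψ hev hy, Finset.mul_sum]
  refine Fintype.sum_equiv (Equiv.addRight ((2 * y)⁻¹ • γ)) _ _ fun a => ?_
  rw [Equiv.coe_addRight, ← AddChar.map_add_eq_mul]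
  congr 1
  have : (a + (2 * y)⁻¹ • γ) ^ 2 = a ^ 2 + y⁻¹ • (γ * a) + (4 * y ^ 2)⁻¹ • γ ^ 2 := by
    have h2L : algebraMap K L 2 = 2 := map_ofNat _ 2
    have h4L : algebraMap K L 4 = 4 := map_ofNat _ 4
    have h2' : (2 : L) ≠ 0 := h2L ▸ (map_ne_zero (algebraMap K L)).2 h2
    have h4' : (4 : L) ≠ 0 := h4L ▸ (map_ne_zero (algebraMap K L)).2 h4
    have hy' : algebraMap K L y ≠ 0 := (map_ne_zero (algebraMap K L)).2 hy
    simp only [Algebra.smul_def, map_inv₀, map_mul, map_pow, h2L, h4L]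
    field_simp
    ring
  rw [this, map_add, map_add, map_smul, map_smul, smul_eq_mul, smul_eq_mul]
  field_simp
  ring

variable (K L) in
/-- The elements of `L` whose square has trace zero. -/
noncomputable def traceSqZero : Finset L := univ.filter fun a => Algebra.trace K L (a ^ 2) = 0

theorem card_mul_sum_traceSqZero (hK : ringChar K ≠ 2) (hψ : ψ.IsPrimitive)
    (hev : Even (Module.finrank K L)) (γ : L) :
    (Fintype.card K : ℂ) * ∑ a ∈ traceSqZero K L, ψ (Algebra.trace K L (γ * a)) =
      ∑ a : L, ψ (Algebra.trace K L (γ * a)) +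
        ((∑ y : K, ψ (-Algebra.trace K L (γ ^ 2) / 4 / y)) - 1) *
        -((quadraticChar K (-1) : ℂ) * Fintype.card K) ^ (Module.finrank K L / 2) := by
  have h1 : (Fintype.card K : ℂ) * ∑ a ∈ traceSqZero K L, ψ (Algebra.trace K L (γ * a)) =
      ∑ y : K, ∑ a : L, ψ (y * Algebra.trace K L (a ^ 2) + Algebra.trace K L (γ * a)) := by
    rw [Finset.sum_comm, traceSqZero, Finset.mul_sum, Finset.sum_filter]
    refine Finset.sum_congr rfl fun a _ => ?_
    simp only [AddChar.map_add_eq_mul]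
    rw [← Finset.sum_mul, AddChar.sum_mulShift _ hψ]
    split_ifs <;> simp
  rw [h1, ← Finset.add_sum_erase univ _ (mem_univ (0 : K)),
    ← Finset.add_sum_erase univ (fun y : K => ψ (-Algebra.trace K L (γ ^ 2) / 4 / y))
      (mem_univ (0 : K)),
    Finset.sum_congr rfl fun y hy =>
      sum_addChar_trace_sq_add hK hψ hev (Finset.ne_of_mem_erase hy) γ, ← Finset.sum_mul]
  simp

theorem sum_traceSqZero_of_trace_eq_zero (hK : ringChar K ≠ 2) (hψ : ψ.IsPrimitive)
    (hev : Even (Module.finrank K L)) {γ : L} (hγ : γ ≠ 0) (h : Algebra.trace K L (γ ^ 2) = 0) :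
    (Fintype.card K : ℂ) * ∑ a ∈ traceSqZero K L, ψ (Algebra.trace K L (γ * a)) =
      (Fintype.card K - 1) *
        -((quadraticChar K (-1) : ℂ) * Fintype.card K) ^ (Module.finrank K L / 2) := by
  rw [card_mul_sum_traceSqZero hK hψ hev, sum_addChar_trace_mul hψ hγ, h]
  simp

theorem sum_traceSqZero_of_trace_ne_zero (hK : ringChar K ≠ 2) (hψ : ψ.IsPrimitive)
    (hev : Even (Module.finrank K L)) {γ : L} (h : Algebra.trace K L (γ ^ 2) ≠ 0) :
    (Fintype.card K : ℂ) * ∑ a ∈ traceSqZero K L, ψ (Algebra.trace K L (γ * a)) =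
      ((quadraticChar K (-1) : ℂ) * Fintype.card K) ^ (Module.finrank K L / 2) := by
  have hγ : γ ≠ 0 := by rintro rfl; simp at h
  have h2 : (2 : K) ≠ 0 := Ring.two_ne_zero hK
  have h4 : (4 : K) ≠ 0 := by
    rw [show (4 : K) = 2 * 2 by norm_num]
    exact mul_ne_zero h2 h2
  rw [card_mul_sum_traceSqZero hK hψ hev, sum_addChar_trace_mul hψ hγ,
    sum_addChar_div hψ (div_ne_zero (neg_ne_zero.2 h) h4)]
  ring

theorem card_mul_card_traceSqZero (hK : ringChar K ≠ 2) (hψ : ψ.IsPrimitive)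
    (hev : Even (Module.finrank K L)) :
    (Fintype.card K : ℂ) * (traceSqZero K L).card = Fintype.card L + (Fintype.card K - 1) *
        -((quadraticChar K (-1) : ℂ) * Fintype.card K) ^ (Module.finrank K L / 2) := by
  simpa using card_mul_sum_traceSqZero (L := L) hK hψ hev 0

/-- The number of zeros of the linear form on `traceSqZero × traceSqZero` given by `(α, β)` when
exactly one of `α ^ 2` and `β ^ 2` has trace zero. -/
theorem card_filter_trace_of_mixed (hK : ringChar K ≠ 2) (hψ : ψ.IsPrimitive)
    (hev : Even (Module.finrank K L)) {α β : L} (hα : α ≠ 0) (hβ : β ≠ 0)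
    (h : (Algebra.trace K L (α ^ 2) = 0 ∧ Algebra.trace K L (β ^ 2) ≠ 0) ∨
      (Algebra.trace K L (α ^ 2) ≠ 0 ∧ Algebra.trace K L (β ^ 2) = 0)) :
    (Fintype.card K : ℂ) ^ 3 * ((traceSqZero K L ×ˢ traceSqZero K L).filter
        fun p => Algebra.trace K L (α * p.1 + β * p.2) = 0).card =
      (Fintype.card K * (traceSqZero K L).card) ^ 2 - (Fintype.card K - 1) ^ 2 *
        (Fintype.card K : ℂ) ^ Module.finrank K L := by
  set G := ((quadraticChar K (-1) : ℂ) * Fintype.card K) ^ (Module.finrank K L / 2) with hG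
  have hG2 : G ^ 2 = (Fintype.card K : ℂ) ^ Module.finrank K L := by
    have h1 : (quadraticChar K (-1) : ℂ) ^ 2 = 1 := by
      exact_mod_cast quadraticChar_sq_one (neg_ne_zero.2 (one_ne_zero (α := K)))
    rw [hG, ← pow_mul, Nat.div_mul_cancel hev.two_dvd, mul_pow]
    nth_rewrite 1 [← Nat.div_mul_cancel hev.two_dvd]
    rw [mul_comm, mul_comm (_ / 2) 2, pow_mul, h1, one_pow, mul_one]
  have htr : ∀ (z : K) (γ : L),
      Algebra.trace K L ((z • γ) ^ 2) = z ^ 2 * Algebra.trace K L (γ ^ 2) := fun z γ => by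
    rw [smul_pow, map_smul, smul_eq_mul]
  have hz : ∀ z ∈ univ.erase (0 : K), (Fintype.card K : ℂ) ^ 2 *
      ((∑ a ∈ traceSqZero K L, ψ (Algebra.trace K L (z • α * a))) *
        ∑ b ∈ traceSqZero K L, ψ (Algebra.trace K L (z • β * b))) =
      -(Fintype.card K - 1) * (Fintype.card K : ℂ) ^ Module.finrank K L := by
    intro z hz
    have hz0 : z ≠ 0 := Finset.ne_of_mem_erase hz
    have hzα := smul_ne_zero hz0 hα
    have hzβ := smul_ne_zero hz0 hβ
    rw [sq, mul_mul_mul_comm, ← hG2]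
    rcases h with ⟨h1, h2⟩ | ⟨h1, h2⟩
    · rw [sum_traceSqZero_of_trace_eq_zero hK hψ hev hzα (by rw [htr, h1, mul_zero]),
        sum_traceSqZero_of_trace_ne_zero hK hψ hev
          (by rw [htr]; exact mul_ne_zero (pow_ne_zero 2 hz0) h2), ← hG]
      ring
    · rw [sum_traceSqZero_of_trace_eq_zero hK hψ hev hzβ (by rw [htr, h2, mul_zero]),
        sum_traceSqZero_of_trace_ne_zero hK hψ hev
          (by rw [htr]; exact mul_ne_zero (pow_ne_zero 2 hz0) h1), ← hG]
      ring
  rw [pow_succ, mul_assoc, card_mul_card_filter_trace hψ, Finset.mul_sum,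
    ← Finset.add_sum_erase univ _ (mem_univ (0 : K)), Finset.sum_congr rfl hz, Finset.sum_const,
    Finset.card_erase_of_mem (mem_univ _), card_univ, nsmul_eq_mul,
    Nat.cast_pred Fintype.card_pos]
  simp only [zero_smul, zero_mul, map_zero, AddChar.map_zero_eq_one, sum_const, nsmul_eq_mul,
    mul_one]
  ring

end TraceSums

theorem neg_quadraticChar_neg_one_mul_pow {q m : ℕ} [Fact q.Prime] (hq : Odd q) (hm : Even m) :
    -((quadraticChar (ZMod q) (-1) : ℂ) * q) ^ (m / 2) = epsEven q m * q ^ (m / 2) := by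
  have hK : ringChar (ZMod q) ≠ 2 := by
    rw [ZMod.ringChar_zmod_n]
    rintro rfl
    exact absurd hq (by decide)
  rw [quadraticChar_neg_one hK, ZMod.card, ZMod.χ₄_eq_neg_one_pow (Nat.odd_iff.1 hq), mul_pow,
    epsEven]
  obtain ⟨r, rfl⟩ := hq
  obtain ⟨s, rfl⟩ := hm
  have h1 : (2 * r + 1) / 2 = r := by omega
  have h2 : (s + s) / 2 = s := by omega
  have h3 : (2 * r + 1 - 1) ^ 2 * (s + s) / 8 = r * r * s := by
    rw [Nat.add_sub_cancel, show (2 * r) ^ 2 * (s + s) = r * r * s * 8 by ring,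
      Nat.mul_div_cancel _ (by norm_num)]
  have h4 : (-1 : ℂ) ^ (r * r) = (-1) ^ r := by
    rcases Nat.even_or_odd r with h | h
    · rw [h.neg_one_pow, (h.mul_right r).neg_one_pow]
    · rw [h.neg_one_pow, (h.mul h).neg_one_pow]
  rw [h1, h2, h3]
  push_cast
  rw [pow_mul _ (r * r), h4]
  ring

theorem epsEven_sq (q m : ℕ) : epsEven q m ^ 2 = 1 := by
  rw [epsEven, neg_sq, ← pow_mul, mul_comm, pow_mul, neg_one_sq, one_pow]

theorem card_filter_defSet_trace_ne_zero {q : ℕ} [Fact q.Prime] {F : Type*} [Field F] [Fintype F]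
    [DecidableEq F] [Algebra (ZMod q) F] (α β : F) :
    (((defSet q F).filter
        fun p => Algebra.trace (ZMod q) F (α * p.1 + β * p.2) ≠ 0).card : ℂ) =
      (traceSqZero (ZMod q) F).card ^ 2 -
        ((traceSqZero (ZMod q) F ×ˢ traceSqZero (ZMod q) F).filter
          fun p => Algebra.trace (ZMod q) F (α * p.1 + β * p.2) = 0).card := by
  have h : (defSet q F).filter (fun p => Algebra.trace (ZMod q) F (α * p.1 + β * p.2) ≠ 0) =
      (traceSqZero (ZMod q) F ×ˢ traceSqZero (ZMod q) F).filter
        fun p => ¬ Algebra.trace (ZMod q) F (α * p.1 + β * p.2) = 0 := by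
    ext ⟨a, b⟩
    simp only [defSet, traceSqZero, mem_filter, mem_univ, true_and, mem_product, ne_eq,
      Prod.mk.injEq]
    constructor
    · rintro ⟨⟨_, h⟩, h'⟩
      exact ⟨h, h'⟩
    · rintro ⟨h, h'⟩
      refine ⟨⟨?_, h⟩, h'⟩
      rintro ⟨rfl, rfl⟩
      simp at h'
  rw [h, eq_sub_iff_add_eq', sq, ← Nat.cast_mul, ← Finset.card_product]
  exact_mod_cast Finset.card_filter_add_card_filter_not _

theorem card_filter_exactly_one_trace_sq_eq_zero {K F : Type*} [Field K] [DecidableEq K] [Field F]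
    [Fintype F] [DecidableEq F] [Algebra K F] :
    ((univ.filter (fun p : F × F => p.1 ≠ 0 ∧ p.2 ≠ 0 ∧
      ((Algebra.trace K F (p.1 ^ 2) = 0 ∧ Algebra.trace K F (p.2 ^ 2) ≠ 0) ∨
       (Algebra.trace K F (p.1 ^ 2) ≠ 0 ∧ Algebra.trace K F (p.2 ^ 2) = 0)))).card : ℤ) =
      2 * (Fintype.card F - (traceSqZero K F).card) * ((traceSqZero K F).card - 1) := by
  set Z := traceSqZero K F with hZ
  have hmem : ∀ a, a ∈ Z ↔ Algebra.trace K F (a ^ 2) = 0 := fun a => by simp [hZ, traceSqZero]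
  have h0 : (0 : F) ∈ Z := by simp [hmem]
  have hne : ∀ a, Algebra.trace K F (a ^ 2) ≠ 0 → a ≠ 0 := by
    rintro _ h rfl
    simp at h
  have hS : univ.filter (fun p : F × F => p.1 ≠ 0 ∧ p.2 ≠ 0 ∧
      ((Algebra.trace K F (p.1 ^ 2) = 0 ∧ Algebra.trace K F (p.2 ^ 2) ≠ 0) ∨
       (Algebra.trace K F (p.1 ^ 2) ≠ 0 ∧ Algebra.trace K F (p.2 ^ 2) = 0))) =
      (Z.erase 0 ×ˢ Zᶜ) ∪ (Zᶜ ×ˢ Z.erase 0) := by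
    ext ⟨a, b⟩
    simp only [mem_filter, mem_univ, true_and, mem_union, mem_product, mem_erase, mem_compl, hmem]
    have ha := hne a
    have hb := hne b
    tauto
  have hdisj : Disjoint (Z.erase 0 ×ˢ Zᶜ) (Zᶜ ×ˢ Z.erase 0) := by
    rw [Finset.disjoint_left]
    rintro ⟨a, b⟩ h1 h2
    simp only [mem_product, mem_erase, mem_compl] at h1 h2
    exact h2.1 h1.1.2
  rw [hS, Finset.card_union_of_disjoint hdisj, Finset.card_product, Finset.card_product,
    Finset.card_erase_of_mem h0, Finset.card_compl]
  have h1 : 1 ≤ Z.card := Finset.card_pos.2 ⟨0, h0⟩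
  push_cast [Nat.cast_sub h1, Nat.cast_sub (Finset.card_le_univ Z)]
  ring

theorem stmt16 (q m : ℕ) [Fact q.Prime] (hq : Odd q) (hm : 2 ≤ m) (hmeven : Even m)
    (F : Type*) [Field F] [Fintype F] [DecidableEq F] [Algebra (ZMod q) F]
    (hF : Fintype.card F = q ^ m)
    (S : Finset (F × F))
    (hS : S = Finset.univ.filter (fun p : F × F => p.1 ≠ 0 ∧ p.2 ≠ 0 ∧
      ((Algebra.trace (ZMod q) F (p.1 ^ 2) = 0 ∧ Algebra.trace (ZMod q) F (p.2 ^ 2) ≠ 0) ∨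
       (Algebra.trace (ZMod q) F (p.1 ^ 2) ≠ 0 ∧ Algebra.trace (ZMod q) F (p.2 ^ 2) = 0)))) :
    (S.card : ℤ) = 2 * ((q : ℤ) - 1) *
        ((q : ℤ) ^ (m - 1) - epsEven q m * (q : ℤ) ^ ((m - 2) / 2)) *
        ((q : ℤ) ^ (m - 1) + epsEven q m * ((q : ℤ) - 1) * (q : ℤ) ^ ((m - 2) / 2) - 1) ∧
    ∀ p ∈ S, (leeW q F p.1 p.2 : ℤ) =
      2 * ((q : ℤ) - 1) * (q : ℤ) ^ (2 * m - 3) +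
        4 * epsEven q m * ((q : ℤ) - 1) ^ 2 * (q : ℤ) ^ ((3 * m - 6) / 2) +
        2 * ((q : ℤ) - 1) ^ 2 * (q : ℤ) ^ (m - 2) := by
  have hK : ringChar (ZMod q) ≠ 2 := by
    rw [ZMod.ringChar_zmod_n]
    rintro rfl
    exact absurd hq (by decide)
  have hψ := ZMod.isPrimitive_stdAddChar q
  have hq0 : (q : ℂ) ≠ 0 := Nat.cast_ne_zero.2 (Fact.out : q.Prime).ne_zero
  have hfin : Module.finrank (ZMod q) F = m := by
    have := Module.card_eq_pow_finrank (K := ZMod q) (V := F)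
    rw [hF, ZMod.card] at this
    exact (Nat.pow_right_injective (Fact.out : q.Prime).two_le this).symm
  have hev : Even (Module.finrank (ZMod q) F) := hfin ▸ hmeven
  have hN := card_mul_card_traceSqZero (L := F) hK hψ hev
  rw [hfin, ZMod.card, neg_quadraticChar_neg_one_mul_pow hq hmeven, hF] at hN
  have hmix := fun (α β : F) => card_filter_trace_of_mixed (α := α) (β := β) hK hψ hev
  simp only [hfin, ZMod.card] at hmix
  have hε : (epsEven q m : ℂ) ^ 2 = 1 := by exact_mod_cast epsEven_sq q m
  have hcard := card_filter_exactly_one_trace_sq_eq_zero (K := ZMod q) (F := F)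
  rw [← hS, hF] at hcard
  obtain ⟨k, rfl⟩ : ∃ k, m = 2 * k + 2 := by
    obtain ⟨s, rfl⟩ := hmeven
    exact ⟨s - 1, by omega⟩
  rw [show 2 * k + 2 - 1 = 2 * k + 1 by omega, show (2 * k + 2 - 2) / 2 = k by omega,
    show 2 * (2 * k + 2) - 3 = 4 * k + 1 by omega, show (3 * (2 * k + 2) - 6) / 2 = 3 * k by omega,
    show 2 * k + 2 - 2 = 2 * k by omega]
  rw [show (2 * k + 2) / 2 = k + 1 by omega] at hN
  set ε := epsEven q (2 * k + 2)
  have hN' : ((traceSqZero (ZMod q) F).card : ℂ) = q ^ (2 * k + 1) + ε * (q - 1) * q ^ k := by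
    apply mul_left_cancel₀ hq0
    rw [hN]
    push_cast
    ring
  have hNZ : ((traceSqZero (ZMod q) F).card : ℤ) = q ^ (2 * k + 1) + ε * (q - 1) * q ^ k := by
    exact_mod_cast hN'
  refine ⟨?_, fun p hp => ?_⟩
  · rw [hcard, hNZ]
    push_cast
    ring
  · rw [hS, mem_filter] at hp
    obtain ⟨-, hα, hβ, h⟩ := hp
    have h1 := hmix p.1 p.2 hα hβ h
    have h2 := hmix p.2 p.1 hβ hα (h.symm.imp And.symm And.symm)
    rw [hN'] at h1 h2
    rw [← Int.cast_inj (α := ℂ), leeW, ← mul_right_inj' (pow_ne_zero 3 hq0)]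
    push_cast
    rw [card_filter_defSet_trace_ne_zero, card_filter_defSet_trace_ne_zero, hN']
    linear_combination -h1 - h2 + 2 * (q : ℂ) ^ 2 * q ^ (2 * k) * (q - 1) ^ 3 * hε
end
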